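/- Assume: (consistency) 1_A • Z = 1_A • Z_d P-almost surely; (ignorability) Z_d and the indicator 1_A are conditionally independent given 𝔪; (overlap) π > 0 P-almost surely. Then the map ω ↦ (1_A(ω)/π(ω)) • Z(ω) is Bochner integrable and E[(1_A/π) • Z] = E[Z_d]. That is, the inverse-propensity-weighted observed outcome identifies the causal map Δ_d = E[Z_d]. -/

import Mathlib

open MeasureTheory ProbabilityTheory


lemma aux_lintegral {Ω : Type*} {mΩ : MeasurableSpace Ω}
    (P : Measure Ω) [IsProbabilityMeasure P] (m : MeasurableSpace Ω) (hm : m ≤ mΩ)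
    (T : Set Ω) (hT : MeasurableSet[mΩ] T) (g : Ω → ENNReal) (hg : Measurable[m] g) :
    ∫⁻ ω in T, g ω ∂P
      = ∫⁻ ω, ENNReal.ofReal ((P[T.indicator (fun _ => (1 : ℝ)) | m]) ω) * g ω ∂P := by
  have hmeas : Measurable[mΩ] (fun ω => ENNReal.ofReal ((P[T.indicator (fun _ => (1 : ℝ)) | m]) ω)) :=
    (stronglyMeasurable_condExp.mono hm).measurable.ennreal_ofReal
  have hi : Integrable (T.indicator (fun _ => (1 : ℝ))) P :=
    (integrable_const (1 : ℝ)).indicator hT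
  have hnn : 0 ≤ᵐ[P] P[T.indicator (fun _ => (1 : ℝ)) | m] :=
    condExp_nonneg (Filter.Eventually.of_forall
      fun ω => Set.indicator_nonneg (fun _ _ => zero_le_one) ω)
  have key : (P.restrict T).trim hm = (P.withDensity
      (fun ω => ENNReal.ofReal ((P[T.indicator (fun _ => (1 : ℝ)) | m]) ω))).trim hm := by
    refine @Measure.ext _ m _ _ fun E hE => ?_
    rw [trim_measurableSet_eq hm hE, trim_measurableSet_eq hm hE,
      withDensity_apply _ (hm E hE), Measure.restrict_apply (hm E hE),
      ← ofReal_integral_eq_lintegral_ofReal integrable_condExp.integrableOn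
        (ae_restrict_of_ae hnn), setIntegral_condExp hm hi hE, setIntegral_indicator hT]
    simp
  rw [← lintegral_trim hm hg, key, lintegral_trim hm hg,
    lintegral_withDensity_eq_lintegral_mul _ hmeas (hg.mono hm le_rfl)]
  rfl

theorem causal_aux
    {Ω : Type*} (𝔪 : MeasurableSpace Ω) [mΩ : MeasurableSpace Ω] [StandardBorelSpace Ω]
    (P : Measure Ω) [IsProbabilityMeasure P]
    {H : Type*} [NormedAddCommGroup H] [InnerProductSpace ℝ H] [CompleteSpace H]
    [SecondCountableTopology H] [MeasurableSpace H] [BorelSpace H]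
    (h𝔪 : 𝔪 ≤ mΩ)
    (A : Set Ω) (hA : MeasurableSet[mΩ] A)
    (Z Zd : Ω → H)
    (hZmeas : StronglyMeasurable[mΩ] Z) (hZdmeas : StronglyMeasurable[mΩ] Zd)
    (hZint : Integrable Z P) (hZdint : Integrable Zd P)
    (π : Ω → ℝ) (hπmeas : Measurable[𝔪] π)
    (hπver : π =ᵐ[P] P[A.indicator (fun _ => (1 : ℝ)) | 𝔪])
    (hconsistency : A.indicator Z =ᵐ[P] A.indicator Zd)
    (hignorability : CondIndepFun 𝔪 h𝔪 Zd (A.indicator (fun _ => (1 : ℝ))) P)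
    (hoverlap : ∀ᵐ ω ∂P, 0 < π ω) :
    Integrable (fun ω => (A.indicator (fun _ => (1 : ℝ)) ω / π ω) • Z ω) P ∧
    (∫ ω, (A.indicator (fun _ => (1 : ℝ)) ω / π ω) • Z ω ∂P = ∫ ω, Zd ω ∂P) := by
  have hπm : Measurable[mΩ] π := hπmeas.mono h𝔪 le_rfl
  set w : Ω → NNReal := fun ω => A.indicator (fun ω => (Real.toNNReal (π ω))⁻¹) ω with hw
  have hwm : Measurable[mΩ] w := (hπm.real_toNNReal.inv).indicator hA
  set Q : @Measure Ω mΩ := P.withDensity (fun ω => (w ω : ENNReal)) with hQ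
  have hZdm : Measurable[mΩ] Zd := hZdmeas.measurable
  have hmap : Q.map Zd = P.map Zd := by
    ext B hB
    have hS : MeasurableSet[mΩ] (Zd ⁻¹' B) := hZdm hB
    rw [Measure.map_apply hZdm hB, Measure.map_apply hZdm hB, hQ, withDensity_apply _ hS]
    have hci := (condIndepFun_iff_condExp_inter_preimage_eq_mul hZdm
      (measurable_const.indicator hA)).1 hignorability B {1} hB (measurableSet_singleton _)
    have hpre : (A.indicator (fun _ => (1 : ℝ))) ⁻¹' {1} = A := by
      ext ω
      by_cases h : ω ∈ A <;> simp [h]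
    rw [hpre] at hci
    have hnn : 0 ≤ᵐ[P] P[(Zd ⁻¹' B).indicator (fun _ => (1 : ℝ)) | 𝔪] :=
      condExp_nonneg (Filter.Eventually.of_forall
        fun ω => Set.indicator_nonneg (fun _ _ => zero_le_one) ω)
    have h1 : ∫⁻ ω in Zd ⁻¹' B, (w ω : ENNReal) ∂P
        = ∫⁻ ω in Zd ⁻¹' B ∩ A, (((Real.toNNReal (π ω))⁻¹ : NNReal) : ENNReal) ∂P := by
      rw [Set.inter_comm, ← setLIntegral_indicator hA]
      refine lintegral_congr fun ω => ?_
      by_cases h : ω ∈ A <;> simp [hw, h]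
    rw [h1, aux_lintegral P 𝔪 h𝔪 _ (hS.inter hA)
      (fun ω => (((Real.toNNReal (π ω))⁻¹ : NNReal) : ENNReal)) hπmeas.real_toNNReal.inv.coe_nnreal_ennreal]
    have h2 := aux_lintegral P 𝔪 h𝔪 _ hS (fun _ => 1) measurable_const
    simp only [lintegral_const, Measure.restrict_apply MeasurableSet.univ, Set.univ_inter,
      one_mul, mul_one] at h2
    rw [h2]
    refine lintegral_congr_ae ?_
    filter_upwards [hci, hπver, hoverlap, hnn] with ω h1 h2 h3 h4
    rw [h1, ← h2, ENNReal.ofReal_mul h4, mul_assoc, ENNReal.coe_inv (by simpa using h3)]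
    change _ * (ENNReal.ofReal (π ω) * (ENNReal.ofReal (π ω))⁻¹) = _
    rw [ENNReal.mul_inv_cancel (by simpa using h3) ENNReal.ofReal_ne_top, mul_one]
  have hae : (fun ω => (A.indicator (fun _ => (1 : ℝ)) ω / π ω) • Z ω)
      =ᵐ[P] fun ω => w ω • Zd ω := by
    filter_upwards [hconsistency, hoverlap] with ω h1 h2
    by_cases h : ω ∈ A
    · simp only [h, Set.indicator_of_mem] at h1
      simp [hw, h, h1, NNReal.smul_def, h2.le]
    · simp [hw, h]
  have hid : AEStronglyMeasurable (id : H → H) (P.map Zd) := aestronglyMeasurable_id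
  have hintQ : Integrable Zd Q := by
    have h1 : Integrable (id : H → H) (P.map Zd) :=
      (integrable_map_measure hid hZdm.aemeasurable).2 hZdint
    rw [← hmap] at h1 hid
    exact (integrable_map_measure hid hZdm.aemeasurable).1 h1
  refine ⟨?_, ?_⟩
  · rw [integrable_congr hae]
    exact (integrable_withDensity_iff_integrable_smul hwm).1 hintQ
  · rw [integral_congr_ae hae, ← integral_withDensity_eq_integral_smul hwm]
    have e1 := integral_map (μ := P) hZdm.aemeasurable hid
    rw [← hmap] at hid e1
    have e2 := integral_map (μ := Q) hZdm.aemeasurable hid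
    exact e2.symm.trans e1

/-- **Lemma C.2: identification of the causal map via inverse propensity weighting.**
Under consistency (`1_A • Z = 1_A • Z_d` a.s.), ignorability (`Z_d ⟂⟂ 1_A | 𝔪`) and
overlap (`π > 0` a.s., where `π = E[1_A | 𝔪]`), the map `ω ↦ (1_A(ω)/π(ω)) • Z(ω)` is
Bochner integrable and `E[(1_A/π) • Z] = E[Z_d]`. -/
theorem causal_map_identification_ipw
    {Ω : Type*} [mΩ : MeasurableSpace Ω] [StandardBorelSpace Ω]
    (P : Measure Ω) [IsProbabilityMeasure P]
    {H : Type*} [NormedAddCommGroup H] [InnerProductSpace ℝ H] [CompleteSpace H]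
    [SecondCountableTopology H] [MeasurableSpace H] [BorelSpace H]
    (𝔪 : MeasurableSpace Ω) (h𝔪 : 𝔪 ≤ mΩ)
    (A : Set Ω) (hA : MeasurableSet[mΩ] A)
    (Z Zd : Ω → H)
    (hZmeas : StronglyMeasurable[mΩ] Z) (hZdmeas : StronglyMeasurable[mΩ] Zd)
    (hZint : Integrable Z P) (hZdint : Integrable Zd P)
    (π : Ω → ℝ) (hπmeas : Measurable[𝔪] π)
    (hπver : π =ᵐ[P] P[A.indicator (fun _ => (1 : ℝ)) | 𝔪])
    (hconsistency : A.indicator Z =ᵐ[P] A.indicator Zd)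
    (hignorability : CondIndepFun 𝔪 h𝔪 Zd (A.indicator (fun _ => (1 : ℝ))) P)
    (hoverlap : ∀ᵐ ω ∂P, 0 < π ω) :
    Integrable (fun ω => (A.indicator (fun _ => (1 : ℝ)) ω / π ω) • Z ω) P ∧
    (∫ ω, (A.indicator (fun _ => (1 : ℝ)) ω / π ω) • Z ω ∂P = ∫ ω, Zd ω ∂P) := 
  causal_aux (mΩ := mΩ) 𝔪 P h𝔪 A hA Z Zd hZmeas hZdmeas hZint hZdint π hπmeas hπver hconsistency
    hignorability hoverlap
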